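/- arXiv:1601.06426 — 6 statements merged into one kernel-verified Lean document; each statement's English description precedes it below -/
import Mathlib

section
/- Let M ≥ 2, let 𝒫 be a set of probability vectors on Fin M every element of which is nonincreasing, let D ∈ ℝ, and let Q be a (𝒫,D)-valid mechanism. Then there exists a (𝒫,D)-valid mechanism Q' such that (i) the diagonal distortions of Q' are sorted: 1 - Q' i i ≤ 1 - Q' j j whenever i ≤ j, and (ii) for every ε ∈ ℝ, Q' is ε-differentially private if and only if Q is ε-differentially private (in particular ε_DP(Q') = ε_DP(Q)). Such a Q' is obtained from Q by relabeling inputs and outputs with a permutation σ of Fin M that sorts the distortions of Q, i.e., Q' i j = Q (σ i) (σ j). -/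
open Finset

def IsMech {M : ℕ} (Q : Fin M → Fin M → ℝ) : Prop :=
  (∀ i j, 0 ≤ Q i j) ∧ (∀ i, ∑ j, Q i j = 1)

def IsDP {M : ℕ} (ε : ℝ) (Q : Fin M → Fin M → ℝ) : Prop :=
  ∀ i₁ i₂ j, Q i₁ j ≤ Real.exp ε * Q i₂ j

def IsProb {M : ℕ} (P : Fin M → ℝ) : Prop :=
  (∀ i, 0 ≤ P i) ∧ ∑ i, P i = 1

def Nonincr {M : ℕ} (P : Fin M → ℝ) : Prop :=
  ∀ i j : Fin M, i ≤ j → P j ≤ P i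

noncomputable def epsDP {M : ℕ} (Q : Fin M → Fin M → ℝ) : ℝ :=
  sInf {ε | 0 ≤ ε ∧ IsDP ε Q}

def hamDist {M : ℕ} (P : Fin M → ℝ) (Q : Fin M → Fin M → ℝ) : ℝ :=
  ∑ i, P i * (1 - Q i i)

def PDValid {M : ℕ} (Ps : Set (Fin M → ℝ)) (D : ℝ) (Q : Fin M → Fin M → ℝ) : Prop :=
  IsMech Q ∧ ∀ P ∈ Ps, hamDist P Q ≤ D

noncomputable def epsStar {M : ℕ} (Ps : Set (Fin M → ℝ)) (D : ℝ) : ℝ :=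
  sInf {x | ∃ Q, PDValid Ps D Q ∧ x = epsDP Q}

theorem isMech_relabel {M : ℕ} {Q : Fin M → Fin M → ℝ} (hQ : IsMech Q)
    (σ : Equiv.Perm (Fin M)) : IsMech (fun i j => Q (σ i) (σ j)) :=
  ⟨fun i j => hQ.1 (σ i) (σ j), fun i => (Equiv.sum_comp σ (Q (σ i))).trans (hQ.2 (σ i))⟩

theorem isDP_relabel_iff {M : ℕ} (ε : ℝ) (Q : Fin M → Fin M → ℝ) (σ : Equiv.Perm (Fin M)) :
    IsDP ε (fun i j => Q (σ i) (σ j)) ↔ IsDP ε Q := by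
  refine ⟨fun h i₁ i₂ j => ?_, fun h i₁ i₂ j => h (σ i₁) (σ i₂) (σ j)⟩
  simpa using h (σ.symm i₁) (σ.symm i₂) (σ.symm j)

theorem hamDist_relabel_le {M : ℕ} {P : Fin M → ℝ} (hP : Nonincr P) {Q : Fin M → Fin M → ℝ}
    {σ : Equiv.Perm (Fin M)} (hσ : Monotone fun i => 1 - Q (σ i) (σ i)) :
    hamDist P (fun i j => Q (σ i) (σ j)) ≤ hamDist P Q := by
  have hanti : Antivary P fun i => 1 - Q (σ i) (σ i) := Antitone.antivary (fun i j => hP i j) hσ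
  simpa [hamDist] using hanti.sum_mul_le_sum_mul_comp_perm (σ := σ⁻¹)

theorem stmt2 {M : ℕ} (hM : 2 ≤ M) (Ps : Set (Fin M → ℝ))
    (hPs : ∀ P ∈ Ps, IsProb P ∧ Nonincr P)
    (D : ℝ) (Q : Fin M → Fin M → ℝ) (hQ : PDValid Ps D Q) :
    ∃ σ : Equiv.Perm (Fin M),
      PDValid Ps D (fun i j => Q (σ i) (σ j)) ∧
      (∀ i j : Fin M, i ≤ j →
        1 - Q (σ i) (σ i) ≤ 1 - Q (σ j) (σ j)) ∧
      (∀ ε : ℝ, IsDP ε (fun i j => Q (σ i) (σ j)) ↔ IsDP ε Q) ∧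
      epsDP (fun i j => Q (σ i) (σ j)) = epsDP Q := by
  have hσ : Monotone fun i => 1 - Q (Tuple.sort (fun k => 1 - Q k k) i)
      (Tuple.sort (fun k => 1 - Q k k) i) := Tuple.monotone_sort fun k => 1 - Q k k
  refine ⟨Tuple.sort fun k => 1 - Q k k,
    ⟨isMech_relabel hQ.1 _, fun P hP => (hamDist_relabel_le (hPs P hP).2 hσ).trans (hQ.2 P hP)⟩,
    fun i j hij => hσ hij, fun ε => isDP_relabel_iff ε Q _, ?_⟩
  simp only [epsDP, isDP_relabel_iff]
end

section
/- Let M ≥ 2, let D be a real with 0 < D < (M-1)/M, let U be the uniform probability vector on Fin M (U i = 1/M), and let Q be a mechanism whose expected Hamming distortion under U satisfies d(U,Q) ≤ D. If Q is ε-differentially private for some ε ≥ 0, then ε ≥ Real.log ((M-1) * (1-D) / D). -/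
open Finset

theorem IsDP.sum_diag_le {M : ℕ} {ε : ℝ} {Q : Fin M → Fin M → ℝ} (hQ : IsMech Q)
    (hdp : IsDP ε Q) :
    ((M : ℝ) - 1) * ∑ i, Q i i ≤ Real.exp ε * (M - ∑ i, Q i i) := by
  have hpair : ∀ i j : Fin M, Q i i ≤
      Real.exp ε * Q j i + if j = i then (1 - Real.exp ε) * Q i i else 0 := by
    intro i j
    split_ifs with h
    · subst h
      linarith
    · simpa using hdp i j i
  have hsum := Finset.sum_le_sum fun i (_ : i ∈ Finset.univ) =>
    Finset.sum_le_sum fun j (_ : j ∈ Finset.univ) => hpair i j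
  have htotal : ∑ i, ∑ j, Q j i = (M : ℝ) := by
    rw [Finset.sum_comm]
    simp [hQ.2]
  simp only [Finset.sum_add_distrib, ← Finset.mul_sum, htotal, Finset.sum_ite_eq',
    Finset.sum_const, Finset.card_univ, Fintype.card_fin, nsmul_eq_mul, Finset.mem_univ,
    if_true] at hsum
  linarith

theorem stmt4 {M : ℕ} (hM : 2 ≤ M) (D : ℝ) (hD0 : 0 < D)
    (hD1 : D < ((M : ℝ) - 1) / M)
    (Q : Fin M → Fin M → ℝ) (hQ : IsMech Q)
    (hdist : hamDist (fun _ : Fin M => (1 : ℝ) / M) Q ≤ D)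
    (ε : ℝ) (hε : 0 ≤ ε) (hdp : IsDP ε Q) :
    Real.log (((M : ℝ) - 1) * (1 - D) / D) ≤ ε := by
  have hM' : (2 : ℝ) ≤ M := by exact_mod_cast hM
  have hM0 : (0 : ℝ) < M := by linarith
  have hD_lt : D < 1 := hD1.trans ((div_lt_one hM0).2 (by linarith))
  have hdiag : (M : ℝ) * (1 - D) ≤ ∑ i, Q i i := by
    have h : hamDist (fun _ : Fin M => (1 : ℝ) / M) Q = (M - ∑ i, Q i i) / M := by
      simp [hamDist, ← Finset.mul_sum, div_eq_inv_mul]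
    rw [h, div_le_iff₀ hM0] at hdist
    linarith
  have hmain := hdp.sum_diag_le hQ
  rw [Real.log_le_iff_le_exp (div_pos (mul_pos (by linarith) (by linarith)) hD0),
    div_le_iff₀ hD0]
  refine le_of_mul_le_mul_left ?_ hM0
  calc (M : ℝ) * (((M : ℝ) - 1) * (1 - D)) = ((M : ℝ) - 1) * (M * (1 - D)) := by ring
    _ ≤ ((M : ℝ) - 1) * ∑ i, Q i i := mul_le_mul_of_nonneg_left hdiag (by linarith)
    _ ≤ Real.exp ε * (M - ∑ i, Q i i) := hmain
    _ ≤ Real.exp ε * (M * D) :=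
      mul_le_mul_of_nonneg_left (by linarith) (Real.exp_pos ε).le
    _ = M * (Real.exp ε * D) := by ring
end

section
/- Let M ≥ 2, let 𝒫 be a nonempty ordered set of probability vectors on Fin M, and let D ≥ 0 be real. Define D^(M-1)(𝒫) := sSup {∑_{i=2}^{M} P i | P ∈ 𝒫} (the supremum over 𝒫 of the total mass outside the largest coordinate). Then there exists a (𝒫,D)-valid mechanism Q that is 0-differentially private if and only if D ≥ D^(M-1)(𝒫). -/
open Finset

theorem sum_filter_one_le_val {M : ℕ} [NeZero M] {P : Fin M → ℝ} (hP : ∑ i, P i = 1) :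
    ∑ i ∈ Finset.univ.filter (fun i : Fin M => 1 ≤ i.val), P i = 1 - P 0 := by
  have hfilter : Finset.univ.filter (fun i : Fin M => 1 ≤ i.val) = Finset.univ.erase 0 := by
    ext i
    simp only [Finset.mem_filter, Finset.mem_univ, true_and, Finset.mem_erase, and_true, ne_eq,
      Fin.ext_iff, Fin.val_zero]
    omega
  rw [hfilter, Finset.sum_erase_eq_sub (Finset.mem_univ _), hP]

/-- A `0`-differentially private mechanism has constant columns. -/
theorem IsDP.eq_of_zero {M : ℕ} {Q : Fin M → Fin M → ℝ} (hQ : IsDP 0 Q) (i₁ i₂ j : Fin M) :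
    Q i₁ j = Q i₂ j :=
  le_antisymm (by simpa using hQ i₁ i₂ j) (by simpa using hQ i₂ i₁ j)

/-- For a nonincreasing source, no `0`-differentially private mechanism has smaller Hamming
distortion than the one that always outputs the first symbol. -/
theorem one_sub_le_hamDist {M : ℕ} [NeZero M] {P : Fin M → ℝ} {Q : Fin M → Fin M → ℝ}
    (hP : ∑ i, P i = 1) (hmono : Nonincr P) (hQ : IsMech Q) (hdp : IsDP 0 Q) :
    1 - P 0 ≤ hamDist P Q := by
  have hle : ∑ i, P i * Q i i ≤ P 0 := calc
    ∑ i, P i * Q i i ≤ ∑ i, P 0 * Q 0 i := by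
      refine Finset.sum_le_sum fun i _ => ?_
      rw [hdp.eq_of_zero i 0 i]
      exact mul_le_mul_of_nonneg_right (hmono 0 i (Fin.zero_le _)) (hQ.1 0 i)
    _ = P 0 := by rw [← Finset.mul_sum, hQ.2 0, mul_one]
  simp only [hamDist, mul_sub, mul_one, Finset.sum_sub_distrib, hP]
  linarith

/-- The Hamming distortion of the mechanism that always outputs the first symbol. -/
theorem hamDist_single_zero {M : ℕ} [NeZero M] {P : Fin M → ℝ} (hP : ∑ i, P i = 1) :
    hamDist P (fun _ => Pi.single 0 1) = 1 - P 0 := by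
  simp [hamDist, mul_sub, Finset.sum_sub_distrib, hP, Pi.single_apply]

theorem stmt6 {M : ℕ} (hM : 2 ≤ M) (Ps : Set (Fin M → ℝ))
    (hne : Ps.Nonempty) (hPs : ∀ P ∈ Ps, IsProb P ∧ Nonincr P)
    (D : ℝ) (hD : 0 ≤ D) :
    (∃ Q : Fin M → Fin M → ℝ, PDValid Ps D Q ∧ IsDP 0 Q) ↔
      sSup {x : ℝ | ∃ P ∈ Ps,
        x = ∑ i ∈ Finset.univ.filter (fun i : Fin M => 1 ≤ i.val), P i} ≤ D := by
  have : NeZero M := ⟨by omega⟩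
  constructor
  · rintro ⟨Q, ⟨hQ, hval⟩, hdp⟩
    obtain ⟨P₀, hP₀⟩ := hne
    refine csSup_le ⟨_, P₀, hP₀, rfl⟩ ?_
    rintro _ ⟨P, hP, rfl⟩
    rw [sum_filter_one_le_val (hPs P hP).1.2]
    exact (one_sub_le_hamDist (hPs P hP).1.2 (hPs P hP).2 hQ hdp).trans (hval P hP)
  · intro h
    refine ⟨fun _ => Pi.single 0 1, ⟨⟨fun _ j => ?_, fun _ => by simp⟩, fun P hP => ?_⟩,
      fun _ _ _ => by simp⟩
    · have hnonneg : (0 : Fin M → ℝ) ≤ Pi.single 0 1 := Pi.single_nonneg.2 zero_le_one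
      exact hnonneg j
    · rw [hamDist_single_zero (hPs P hP).1.2, ← sum_filter_one_le_val (hPs P hP).1.2]
      refine le_trans (le_csSup ?_ (Set.mem_ofPred.2 ⟨P, hP, rfl⟩)) h
      refine ⟨1, ?_⟩
      rintro _ ⟨R, hR, rfl⟩
      rw [sum_filter_one_le_val (hPs R hR).1.2]
      linarith [(hPs R hR).1.1 0]
end

section
/- Let M ≥ 2, let 0 ≤ k ≤ M-2, write m := M - k (so m ≥ 2), and let d₁, …, d_m be reals with 0 < d₁ ≤ d₂ ≤ … ≤ d_m < 1 and ∑_{i=1}^{m} d_i ≤ m - 1. Define Q : Fin M → Fin M → ℝ (indices 1,…,M) by: Q i i = 1 - d_i for i ≤ m; Q i j = d_i * (1 - d_j) / (∑_{l ≤ m, l ≠ i} (1 - d_l)) for i, j ≤ m with i ≠ j; Q i j = Q m j for i > m and j ≤ m; and Q i j = 0 for j > m. Then Q is a mechanism whose diagonal distortions satisfy 1 - Q i i = d_i for i ≤ m and 1 - Q i i = 1 for i > m, and its DP leakage is ε_DP(Q) = Real.log ((m - 1 - ∑_{i=2}^{m} d_i) / d₁). -/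
open Finset

theorem stmt10 {M : ℕ} (hM : 2 ≤ M) (k : ℕ) (hk : k ≤ M - 2)
    (d : Fin M → ℝ)
    (hd0 : 0 < d ⟨0, by omega⟩)
    (hmono : ∀ i j : Fin M, i.val < M - k → j.val < M - k → i ≤ j → d i ≤ d j)
    (hlt1 : ∀ i : Fin M, i.val < M - k → d i < 1)
    (hsum : ∑ i ∈ Finset.univ.filter (fun i : Fin M => i.val < M - k), d i
              ≤ (M : ℝ) - (k : ℝ) - 1)
    (Q : Fin M → Fin M → ℝ)
    (hQdef : ∀ i j : Fin M,
      Q i j =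
        if M - k ≤ j.val then 0
        else if i.val < M - k then
          (if i = j then 1 - d i
           else d i * (1 - d j) /
             (∑ l ∈ Finset.univ.filter (fun l : Fin M => l.val < M - k ∧ l ≠ i), (1 - d l)))
        else
          (if (⟨M - k - 1, by omega⟩ : Fin M) = j then 1 - d ⟨M - k - 1, by omega⟩
           else d ⟨M - k - 1, by omega⟩ * (1 - d j) /
             (∑ l ∈ Finset.univ.filter
                (fun l : Fin M => l.val < M - k ∧ l ≠ ⟨M - k - 1, by omega⟩), (1 - d l)))) :
    IsMech Q ∧
    (∀ i : Fin M, i.val < M - k → 1 - Q i i = d i) ∧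
    (∀ i : Fin M, M - k ≤ i.val → 1 - Q i i = 1) ∧
    epsDP Q = Real.log
      (((M : ℝ) - (k : ℝ) - 1 -
          ∑ i ∈ Finset.univ.filter (fun i : Fin M => 1 ≤ i.val ∧ i.val < M - k), d i)
        / d ⟨0, by omega⟩) := by
  obtain ⟨m, hm⟩ : ∃ m, m = M - k := ⟨_, rfl⟩
  have hm2 : 2 ≤ m := by omega
  have hmM : m ≤ M := by omega
  have hmR : (M : ℝ) - (k : ℝ) = m := by
    rw [hm, Nat.cast_sub (by omega)]
  simp only [← hm] at hmono hlt1 hsum hQdef ⊢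
  rw [hmR] at hsum ⊢
  obtain ⟨A, hA⟩ : ∃ A : Finset (Fin M), A = univ.filter (fun i : Fin M => i.val < m) :=
    ⟨_, rfl⟩
  have memA : ∀ i, i ∈ A ↔ i.val < m := by intro i; simp [hA]
  have cardA : A.card = m := by
    rw [hA, Fin.card_filter_val_lt, min_eq_right hmM]
  rw [← hA] at hsum
  obtain ⟨z, hz⟩ : ∃ z : Fin M, z = ⟨0, by omega⟩ := ⟨_, rfl⟩
  obtain ⟨last, hlast⟩ : ∃ t : Fin M, t = ⟨m - 1, by omega⟩ := ⟨_, rfl⟩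
  rw [← hz] at hd0 ⊢
  simp only [← hlast] at hQdef
  have hzA : z ∈ A := by rw [memA, hz]; simp only; omega
  have hlastA : last ∈ A := by rw [memA, hlast]; simp only; omega
  have hz_le : ∀ i ∈ A, d z ≤ d i := fun i hi =>
    hmono z i ((memA z).1 hzA) ((memA i).1 hi) (by rw [hz]; exact Nat.zero_le _)
  have hpos : ∀ i ∈ A, 0 < d i := fun i hi => hd0.trans_le (hz_le i hi)
  have hlt : ∀ i ∈ A, 0 < 1 - d i := fun i hi => sub_pos.2 (hlt1 i ((memA i).1 hi))
  obtain ⟨c, hc⟩ : ∃ c : ℝ, c = m - 1 - ∑ i ∈ A, d i := ⟨_, rfl⟩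
  have hc0 : 0 ≤ c := by linarith
  have hsumA : ∑ l ∈ A, (1 - d l) = c + 1 := by
    rw [sum_sub_distrib, sum_const, cardA, hc, nsmul_eq_mul]; ring
  have hden : ∀ i ∈ A,
      ∑ l ∈ univ.filter (fun l : Fin M => l.val < m ∧ l ≠ i), (1 - d l) = c + d i := by
    intro i hi
    have h1 : univ.filter (fun l : Fin M => l.val < m ∧ l ≠ i) = A.erase i := by
      ext l; simp [hA, and_comm]
    have h2 := add_sum_erase A (fun l => 1 - d l) hi
    rw [h1]; linarith
  have hR : (m : ℝ) - 1 - ∑ i ∈ univ.filter (fun i : Fin M => 1 ≤ i.val ∧ i.val < m), d i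
      = c + d z := by
    have h1 : univ.filter (fun i : Fin M => 1 ≤ i.val ∧ i.val < m) = A.erase z := by
      ext l
      simp only [mem_filter, mem_univ, true_and, mem_erase, memA, ne_eq, hz, Fin.ext_iff]
      omega
    have h2 := add_sum_erase A d hzA
    rw [h1]; linarith
  rw [hR]
  obtain ⟨r, hr⟩ : ∃ r : Fin M → Fin M, r = fun i => if i.val < m then i else last :=
    ⟨_, rfl⟩
  have hrA : ∀ i, r i ∈ A := by
    intro i
    rw [hr]
    by_cases h : i.val < m
    · simpa [h] using (memA i).2 h
    · simpa [h] using hlastA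
  have hrid : ∀ i ∈ A, r i = i := by
    intro i hi
    simp [hr, (memA i).1 hi]
  have hQ0 : ∀ i j, j ∉ A → Q i j = 0 := by
    intro i j hj
    rw [memA, not_lt] at hj
    rw [hQdef, if_pos hj]
  have hQ : ∀ i, ∀ j ∈ A,
      Q i j = if r i = j then 1 - d j else (1 - d j) * (d (r i) / (c + d (r i))) := by
    intro i j hj
    rw [hQdef, if_neg (not_le.2 ((memA j).1 hj))]
    by_cases h : i.val < m
    · rw [if_pos h, hden i ((memA i).2 h), hrid i ((memA i).2 h)]
      split_ifs with e
      · rw [e]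
      · ring
    · have : r i = last := by simp [hr, h]
      rw [if_neg h, hden last hlastA, this]
      split_ifs with e
      · rw [e]
      · ring
  have hf_le : ∀ i ∈ A, d i / (c + d i) ≤ 1 := fun i hi =>
    div_le_one_of_le₀ (by linarith) (by linarith [hpos i hi])
  have hf_z : ∀ i ∈ A, d z / (c + d z) ≤ d i / (c + d i) := by
    intro i hi
    have := hz_le i hi
    rw [div_le_div_iff₀ (by linarith) (by linarith [hpos i hi])]
    nlinarith
  have hf_pos : 0 < d z / (c + d z) := div_pos hd0 (by linarith)
  have hQ_le : ∀ i, ∀ j ∈ A, Q i j ≤ 1 - d j := by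
    intro i j hj
    rw [hQ i j hj]
    split_ifs
    · exact le_rfl
    · exact mul_le_of_le_one_right (hlt j hj).le (hf_le _ (hrA i))
  have hQ_ge : ∀ i, ∀ j ∈ A, (1 - d j) * (d z / (c + d z)) ≤ Q i j := by
    intro i j hj
    rw [hQ i j hj]
    split_ifs
    · exact mul_le_of_le_one_right (hlt j hj).le (hf_le z hzA)
    · exact mul_le_mul_of_nonneg_left (hf_z _ (hrA i)) (hlt j hj).le
  have hDP : ∀ ε, IsDP ε Q ↔ (c + d z) / d z ≤ Real.exp ε := by
    intro ε
    rw [div_le_iff₀ hd0]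
    constructor
    · intro h
      obtain ⟨o, ho⟩ : ∃ o : Fin M, o = ⟨1, by omega⟩ := ⟨_, rfl⟩
      have hoA : o ∈ A := by rw [memA, ho]; simp only; omega
      have hzo : z ≠ o := by rw [hz, ho, ne_eq, Fin.ext_iff]; simp
      have h1 := h o z o
      rw [hQ o o hoA, hQ z o hoA, hrid o hoA, hrid z hzA, if_pos rfl, if_neg hzo] at h1
      have h2 : (1 - d o) * 1 ≤ (1 - d o) * (Real.exp ε * (d z / (c + d z))) := by linarith
      have h3 := le_of_mul_le_mul_left h2 (hlt o hoA)
      rwa [← mul_div_assoc, le_div_iff₀ (by linarith), one_mul] at h3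
    · intro h i₁ i₂ j
      by_cases hj : j ∈ A
      · have h1 : 1 ≤ Real.exp ε * (d z / (c + d z)) := by
          rwa [← mul_div_assoc, le_div_iff₀ (by linarith), one_mul]
        calc Q i₁ j ≤ 1 - d j := hQ_le i₁ j hj
          _ ≤ (1 - d j) * (Real.exp ε * (d z / (c + d z))) :=
            le_mul_of_one_le_right (hlt j hj).le h1
          _ = Real.exp ε * ((1 - d j) * (d z / (c + d z))) := by ring
          _ ≤ Real.exp ε * Q i₂ j :=
            mul_le_mul_of_nonneg_left (hQ_ge i₂ j hj) (Real.exp_pos ε).le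
      · rw [hQ0 i₁ j hj, hQ0 i₂ j hj, mul_zero]
  refine ⟨⟨?_, ?_⟩, ?_, ?_, ?_⟩
  · intro i j
    by_cases hj : j ∈ A
    · exact (mul_pos (hlt j hj) hf_pos).le.trans (hQ_ge i j hj)
    · exact (hQ0 i j hj).ge
  · intro i
    rw [← sum_subset (subset_univ A) (fun j _ hj => hQ0 i j hj),
      ← add_sum_erase A _ (hrA i), hQ i _ (hrA i), if_pos rfl]
    have h1 : ∑ j ∈ A.erase (r i), Q i j
        = ∑ j ∈ A.erase (r i), (1 - d j) * (d (r i) / (c + d (r i))) :=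
      sum_congr rfl fun j hj => by
        rw [hQ i j (mem_of_mem_erase hj), if_neg (ne_of_mem_erase hj).symm]
    have h2 := add_sum_erase A (fun l => 1 - d l) (hrA i)
    have h3 : ∑ j ∈ A.erase (r i), (1 - d j) = c + d (r i) := by linarith
    have h4 : c + d (r i) ≠ 0 := by have := hpos _ (hrA i); positivity
    rw [h1, ← sum_mul, h3, mul_div_cancel₀ _ h4]
    ring
  · intro i hi
    have hi' := (memA i).2 hi
    rw [hQ i i hi', hrid i hi', if_pos rfl]
    ring
  · intro i hi
    rw [hQ0 i i (by rw [memA]; omega), sub_zero]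
  · have hone : 1 ≤ (c + d z) / d z := by
      rw [le_div_iff₀ hd0]; linarith
    have hset : {ε | 0 ≤ ε ∧ IsDP ε Q} = Set.Ici (Real.log ((c + d z) / d z)) := by
      ext ε
      rw [Set.mem_ofPred_eq, hDP, Set.mem_Ici, ← Real.log_le_iff_le_exp (by linarith)]
      exact and_iff_right_of_imp (Real.log_nonneg hone).trans
    rw [epsDP, hset, csInf_Ici]
end

section
/- Let M ≥ 2 and let 𝒫 be a convex set of probability vectors on Fin M containing the uniform vector U (U i = 1/M). Define the optimal information-theoretic leakage ε*_IT(𝒫,D) := sInf { sSup {I(P;Q) | P ∈ 𝒫} | Q is a (𝒫,D)-valid mechanism }. Then for every real D with 0 ≤ D < (M-1)/M, ε*_IT(𝒫,D) = Real.log M - H(D) - D * Real.log (M-1), where H(D) := -D * Real.log D - (1-D) * Real.log (1-D) (with the convention 0 * log 0 = 0); and for (M-1)/M ≤ D ≤ 1, ε*_IT(𝒫,D) = 0. -/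
open Finset

/-- Mutual information `I(P;Q)` (with the convention `0 * log 0 = 0`, which is automatic
here since any summand with `P i * Q i j = 0` vanishes). -/
noncomputable def MI {M : ℕ} (P : Fin M → ℝ) (Q : Fin M → Fin M → ℝ) : ℝ :=
  ∑ i, ∑ j, P i * Q i j * Real.log (Q i j / ∑ k, P k * Q k j)

/-- The optimal (worst-case) information-theoretic leakage. -/
noncomputable def epsITStar {M : ℕ} (Ps : Set (Fin M → ℝ)) (D : ℝ) : ℝ :=
  sInf {x : ℝ | ∃ Q : Fin M → Fin M → ℝ, PDValid Ps D Q ∧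
    x = sSup {y : ℝ | ∃ P ∈ Ps, y = MI P Q}}

lemma sub_le_mul_log_div {x y : ℝ} (hx : 0 ≤ x) (hy : 0 ≤ y) (h : y = 0 → x = 0) :
    x - y ≤ x * Real.log (x / y) := by
  rcases hx.eq_or_lt with rfl | hx
  · simpa using hy
  have hy' : 0 < y := lt_of_le_of_ne hy fun h0 => hx.ne' (h h0.symm)
  have h1 := Real.one_sub_inv_le_log_of_pos (div_pos hx hy')
  calc x - y = x * (1 - (x / y)⁻¹) := by field_simp
    _ ≤ _ := mul_le_mul_of_nonneg_left h1 hx.le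

lemma sum_output {M : ℕ} {P : Fin M → ℝ} {Q : Fin M → Fin M → ℝ} (hP : IsProb P)
    (hQ : IsMech Q) : ∑ j, ∑ k, P k * Q k j = 1 := by
  rw [Finset.sum_comm]
  simp_rw [← Finset.mul_sum, hQ.2, mul_one, hP.2]

lemma isProb_uniform {M : ℕ} (hM : 0 < M) : IsProb (fun _ : Fin M => (1 : ℝ) / M) := by
  have : (M : ℝ) ≠ 0 := by positivity
  exact ⟨fun _ => by positivity, by simp [this]⟩

/-- Comparing the output law with the uniform law bounds the mutual information from above. -/
lemma MI_le {M : ℕ} (hM : 0 < M) {P : Fin M → ℝ} {Q : Fin M → Fin M → ℝ} (hP : IsProb P)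
    (hQ : IsMech Q) : MI P Q ≤ ∑ i, ∑ j, P i * Q i j * Real.log (M * Q i j) := by
  have hM' : (0 : ℝ) < M := by positivity
  have hterm : ∀ i j, P i * Q i j * Real.log (Q i j / ∑ k, P k * Q k j) =
      P i * Q i j * Real.log (M * Q i j)
        - P i * Q i j * Real.log ((∑ k, P k * Q k j) / (1 / M)) := by
    intro i j
    rcases (mul_nonneg (hP.1 i) (hQ.1 i j)).eq_or_lt with h | h
    · simp [← h]
    have hq : 0 < ∑ k, P k * Q k j := h.trans_le
      (Finset.single_le_sum (f := fun k => P k * Q k j)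
        (fun k _ => mul_nonneg (hP.1 k) (hQ.1 k j)) (Finset.mem_univ i))
    have hQ0 : Q i j ≠ 0 := fun h0 => by simp [h0] at h
    rw [Real.log_div hQ0 hq.ne', Real.log_mul hM'.ne' hQ0, Real.log_div hq.ne' (by positivity),
      one_div, Real.log_inv]
    ring
  have hkl : 0 ≤ ∑ i, ∑ j, P i * Q i j * Real.log ((∑ k, P k * Q k j) / (1 / M)) := by
    rw [Finset.sum_comm]
    simp_rw [← Finset.sum_mul]
    have h1 : ∑ j, ((∑ k, P k * Q k j) - 1 / (M : ℝ)) = 0 := by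
      rw [Finset.sum_sub_distrib, sum_output hP hQ, (isProb_uniform hM).2, sub_self]
    rw [← h1]
    refine Finset.sum_le_sum fun j _ => sub_le_mul_log_div
      (Finset.sum_nonneg fun k _ => mul_nonneg (hP.1 k) (hQ.1 k j)) (by positivity) fun h => ?_
    exact absurd h (by positivity)
  unfold MI
  simp_rw [hterm, Finset.sum_sub_distrib]
  linarith

lemma IsMech.le_one {M : ℕ} {Q : Fin M → Fin M → ℝ} (hQ : IsMech Q) (i j : Fin M) :
    Q i j ≤ 1 :=
  (Finset.single_le_sum (f := Q i) (fun k _ => hQ.1 i k) (Finset.mem_univ j)).trans_eq (hQ.2 i)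

lemma MI_le_log {M : ℕ} (hM : 0 < M) {P : Fin M → ℝ} {Q : Fin M → Fin M → ℝ} (hP : IsProb P)
    (hQ : IsMech Q) : MI P Q ≤ Real.log M := by
  have hM' : (0 : ℝ) < M := by positivity
  refine (MI_le hM hP hQ).trans ?_
  calc ∑ i, ∑ j, P i * Q i j * Real.log (M * Q i j)
      ≤ ∑ i, ∑ j, P i * Q i j * Real.log M := by
        refine Finset.sum_le_sum fun i _ => Finset.sum_le_sum fun j _ => ?_
        rcases (hQ.1 i j).eq_or_lt with h | h
        · simp [← h]
        · refine mul_le_mul_of_nonneg_left (Real.log_le_log (by positivity) ?_)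
            (mul_nonneg (hP.1 i) h.le)
          nlinarith [hQ.le_one i j]
    _ = Real.log M := by
        simp_rw [← Finset.sum_mul, ← Finset.mul_sum, hQ.2, mul_one, hP.2, one_mul]

/-- Every reverse channel `W` yields a lower bound on the mutual information at the
uniform law. -/
lemma le_MI_uniform {M : ℕ} (hM : 0 < M) {Q W : Fin M → Fin M → ℝ} (hQ : IsMech Q)
    (hW : ∀ i j, 0 ≤ W i j) (hW1 : ∀ j, ∑ i, W i j = 1) (hWQ : ∀ i j, W i j = 0 → Q i j = 0) :
    ∑ i, ∑ j, (1 : ℝ) / M * Q i j * Real.log (M * W i j) ≤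
      MI (fun _ : Fin M => (1 : ℝ) / M) Q := by
  have hM' : (0 : ℝ) < M := by positivity
  have hP := isProb_uniform hM
  have hterm : ∀ i j, (1 : ℝ) / M * Q i j * Real.log (M * W i j)
      + (1 / M * Q i j - (∑ k, 1 / M * Q k j) * W i j) ≤
      1 / M * Q i j * Real.log (Q i j / ∑ k, 1 / M * Q k j) := by
    intro i j
    have hq0 : 0 ≤ ∑ k, 1 / M * Q k j :=
      Finset.sum_nonneg fun k _ => mul_nonneg (by positivity) (hQ.1 k j)
    rcases (hQ.1 i j).eq_or_lt with h | h
    · rw [← h]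
      have := mul_nonneg hq0 (hW i j)
      simp only [mul_zero, zero_mul]
      linarith
    have hq : 0 < ∑ k, 1 / M * Q k j := (by positivity : 0 < 1 / M * Q i j).trans_le
      (Finset.single_le_sum (f := fun k => 1 / M * Q k j)
        (fun k _ => mul_nonneg (by positivity) (hQ.1 k j)) (Finset.mem_univ i))
    have hw : W i j ≠ 0 := fun h0 => h.ne' (hWQ i j h0)
    have key := sub_le_mul_log_div (x := 1 / M * Q i j)
      (y := (∑ k, 1 / M * Q k j) * W i j) (by positivity) (mul_nonneg hq0 (hW i j))
      (fun h0 => absurd h0 (mul_ne_zero hq.ne' hw))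
    rw [Real.log_div (by positivity) (mul_ne_zero hq.ne' hw), Real.log_mul (by positivity) h.ne',
      Real.log_mul hq.ne' hw, one_div, Real.log_inv, ← one_div] at key
    rw [Real.log_div h.ne' hq.ne', Real.log_mul hM'.ne' hw]
    linarith
  have hsum := Finset.sum_le_sum fun i (_ : i ∈ Finset.univ) =>
    Finset.sum_le_sum fun j (_ : j ∈ Finset.univ) => hterm i j
  have h1 : ∑ i, ∑ j, (1 / M * Q i j - (∑ k, 1 / M * Q k j) * W i j) = 0 := by
    rw [Finset.sum_comm]
    refine Finset.sum_eq_zero fun j _ => ?_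
    rw [Finset.sum_sub_distrib, ← Finset.mul_sum (f := fun i => W i j), hW1, mul_one, sub_self]
  simp_rw [Finset.sum_add_distrib] at hsum
  rw [h1, add_zero] at hsum
  exact hsum

/-- The symmetric channel with error probability `D`. -/
noncomputable def symChannel (M : ℕ) (D : ℝ) (i j : Fin M) : ℝ :=
  if j = i then 1 - D else D / ((M : ℝ) - 1)

lemma symChannel_comm {M : ℕ} (D : ℝ) (i j : Fin M) :
    symChannel M D i j = symChannel M D j i :=
  if_congr eq_comm rfl rfl

lemma sum_mul_ite_eq {M : ℕ} {q : Fin M → ℝ} (hq : ∑ j, q j = 1) (i : Fin M) (a b : ℝ) :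
    ∑ j, q j * (if j = i then a else b) = (1 - (1 - q i)) * a + (1 - q i) * b := by
  have h : ∀ j, q j * (if j = i then a else b) =
      q j * b + if j = i then q j * (a - b) else 0 := fun j => by
    split_ifs <;> ring
  simp_rw [h, Finset.sum_add_distrib, ← Finset.sum_mul, hq, Finset.sum_ite_eq']
  simp only [Finset.mem_univ, if_true]
  ring

lemma isMech_symChannel {M : ℕ} (hM : 2 ≤ M) {D : ℝ} (h0 : 0 ≤ D) (h1 : D ≤ 1) :
    IsMech (symChannel M D) := by
  have hM' : (2 : ℝ) ≤ M := by exact_mod_cast hM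
  have hM1 : (M : ℝ) - 1 ≠ 0 := by linarith
  refine ⟨fun i j => ?_, fun i => ?_⟩
  · unfold symChannel
    split_ifs
    · linarith
    · exact div_nonneg h0 (by linarith)
  · have hu := (isProb_uniform (M := M) (by omega)).2
    have h := sum_mul_ite_eq hu i (1 - D) (D / ((M : ℝ) - 1))
    rw [← Finset.mul_sum] at h
    have h2 : ∑ j, symChannel M D i j =
        M * ((1 : ℝ) / M * ∑ j, if j = i then 1 - D else D / ((M : ℝ) - 1)) := by
      simp only [symChannel]
      field_simp
    rw [h2, h]
    field_simp
    ring

lemma hamDist_symChannel {M : ℕ} {P : Fin M → ℝ} (hP : IsProb P) (D : ℝ) :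
    hamDist P (symChannel M D) = D := by
  simp [hamDist, symChannel, ← Finset.sum_mul, hP.2]

lemma sum_mul_log_symChannel {M : ℕ} {P : Fin M → ℝ} {Q : Fin M → Fin M → ℝ} (hP : IsProb P)
    (hQ : IsMech Q) (D : ℝ) :
    ∑ i, ∑ j, P i * Q i j * Real.log (M * symChannel M D i j) =
      (1 - hamDist P Q) * Real.log (M * (1 - D))
        + hamDist P Q * Real.log (M * (D / ((M : ℝ) - 1))) := by
  have h : ∀ i j, Real.log (M * symChannel M D i j) =
      if j = i then Real.log (M * (1 - D)) else Real.log (M * (D / ((M : ℝ) - 1))) := by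
    intro i j
    unfold symChannel
    split_ifs <;> rfl
  simp_rw [h, mul_assoc, ← Finset.mul_sum]
  simp_rw [sum_mul_ite_eq (hQ.2 _), mul_add, Finset.sum_add_distrib, ← mul_assoc,
    ← Finset.sum_mul, mul_sub (P _) 1 (1 - Q _ _), Finset.sum_sub_distrib, mul_one, hP.2]
  rfl

lemma epsITStar_eq {M : ℕ} (hM : 0 < M) {Ps : Set (Fin M → ℝ)} (hPs : ∀ P ∈ Ps, IsProb P)
    (hU : (fun _ : Fin M => (1 : ℝ) / M) ∈ Ps) {D v : ℝ} {Q₀ : Fin M → Fin M → ℝ}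
    (hQ₀ : PDValid Ps D Q₀) (hub : ∀ P ∈ Ps, MI P Q₀ ≤ v)
    (hlb : ∀ Q, PDValid Ps D Q → v ≤ MI (fun _ : Fin M => (1 : ℝ) / M) Q) :
    epsITStar Ps D = v := by
  have hle : ∀ Q, PDValid Ps D Q → v ≤ sSup {y : ℝ | ∃ P ∈ Ps, y = MI P Q} := by
    intro Q hQ
    refine (hlb Q hQ).trans (le_csSup ⟨Real.log M, ?_⟩ ⟨_, hU, rfl⟩)
    rintro y ⟨P, hP, rfl⟩
    exact MI_le_log hM (hPs P hP) hQ.1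
  refine IsLeast.csInf_eq ⟨⟨Q₀, hQ₀, le_antisymm (hle Q₀ hQ₀) ?_⟩, ?_⟩
  · refine csSup_le ⟨_, _, hU, rfl⟩ ?_
    rintro y ⟨P, hP, rfl⟩
    exact hub P hP
  · rintro x ⟨Q, hQ, rfl⟩
    exact hle Q hQ

theorem stmt13 {M : ℕ} (hM : 2 ≤ M) (Ps : Set (Fin M → ℝ))
    (hPs : ∀ P ∈ Ps, IsProb P) (hconv : Convex ℝ Ps)
    (hU : (fun _ : Fin M => (1 : ℝ) / M) ∈ Ps) :
    (∀ D : ℝ, 0 ≤ D → D < ((M : ℝ) - 1) / M →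
      epsITStar Ps D =
        Real.log M - (-D * Real.log D - (1 - D) * Real.log (1 - D))
          - D * Real.log ((M : ℝ) - 1)) ∧
    (∀ D : ℝ, ((M : ℝ) - 1) / M ≤ D → D ≤ 1 → epsITStar Ps D = 0) := by
  have hM0 : 0 < M := by omega
  have hMr : (2 : ℝ) ≤ M := by exact_mod_cast hM
  have hM1 : (0 : ℝ) < (M : ℝ) - 1 := by linarith
  have hMp : (0 : ℝ) < M := by linarith
  have hcol : ∀ {D : ℝ}, 0 ≤ D → D ≤ 1 → ∀ j, ∑ i, symChannel M D i j = 1 := by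
    intro D h0 h1 j
    simp_rw [symChannel_comm D _ j]
    exact (isMech_symChannel hM h0 h1).2 j
  refine ⟨fun D h0 hD => ?_, fun D hD h1 => ?_⟩
  · have hDM : D * M < M - 1 := (lt_div_iff₀ hMp).1 hD
    have hD1 : D < 1 := by nlinarith
    have hS := isMech_symChannel hM h0 hD1.le
    have hval : Real.log M - (-D * Real.log D - (1 - D) * Real.log (1 - D))
          - D * Real.log ((M : ℝ) - 1) =
        (1 - D) * Real.log (M * (1 - D)) + D * Real.log (M * (D / ((M : ℝ) - 1))) := by
      rcases h0.eq_or_lt with rfl | h0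
      · simp
      rw [Real.log_mul hMp.ne' (by linarith), Real.log_mul hMp.ne' (by positivity),
        Real.log_div h0.ne' hM1.ne']
      ring
    rw [hval]
    refine epsITStar_eq hM0 hPs hU (Q₀ := symChannel M D)
      ⟨hS, fun P hP => (hamDist_symChannel (hPs P hP) D).le⟩ (fun P hP => ?_) (fun Q hQ => ?_)
    · refine (MI_le hM0 (hPs P hP) hS).trans_eq ?_
      rw [sum_mul_log_symChannel (hPs P hP) hS, hamDist_symChannel (hPs P hP)]
    · have hd := hQ.2 _ hU
      have hnn : ∀ i ∈ Finset.univ, 0 ≤ (1 : ℝ) / M * (1 - Q i i) := fun i _ =>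
        mul_nonneg (by positivity) (sub_nonneg.2 (hQ.1.le_one i i))
      have hWQ : ∀ i j, symChannel M D i j = 0 → Q i j = 0 := by
        intro i j h
        unfold symChannel at h
        split_ifs at h with hij
        · linarith
        have hD0 : D = 0 := by
          rcases div_eq_zero_iff.1 h with h | h
          · exact h
          · linarith
        rw [hD0] at hd
        have hi := (Finset.sum_eq_zero_iff_of_nonneg hnn).1
          (le_antisymm hd (Finset.sum_nonneg hnn)) i (Finset.mem_univ i)
        have hii : Q i i = 1 := by
          rcases mul_eq_zero.1 hi with h | h
          · exact absurd h (by positivity)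
          · linarith
        have h2 := Finset.add_le_sum (f := Q i) (s := Finset.univ) (fun k _ => hQ.1.1 i k)
          (Finset.mem_univ i) (Finset.mem_univ j) (Ne.symm hij)
        linarith [hQ.1.2 i, hQ.1.1 i j]
      refine le_trans ?_ (le_MI_uniform hM0 hQ.1 hS.1 (hcol h0 hD1.le) hWQ)
      rw [sum_mul_log_symChannel (hPs _ hU) hQ.1]
      rcases h0.eq_or_lt with rfl | h0
      · have : hamDist (fun _ : Fin M => (1 : ℝ) / M) Q = 0 :=
          le_antisymm hd (Finset.sum_nonneg hnn)
        rw [this]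
      have hlog : Real.log (M * (D / ((M : ℝ) - 1))) ≤ Real.log (M * (1 - D)) := by
        refine Real.log_le_log (by positivity) (mul_le_mul_of_nonneg_left ?_ hMp.le)
        rw [div_le_iff₀ hM1]
        linarith
      nlinarith
  · have h0' : (0 : ℝ) ≤ ((M : ℝ) - 1) / M := by positivity
    have hS := isMech_symChannel hM h0' (hD.trans h1)
    have ha : (M : ℝ) * (1 - ((M : ℝ) - 1) / M) = 1 := by
      field_simp
      ring
    have hb : (M : ℝ) * (((M : ℝ) - 1) / M / ((M : ℝ) - 1)) = 1 := by
      field_simp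
    have hzero : ∀ P ∈ Ps, ∀ Q, IsMech Q → ∑ i, ∑ j,
        P i * Q i j * Real.log (M * symChannel M (((M : ℝ) - 1) / M) i j) = 0 := by
      intro P hP Q hQ
      rw [sum_mul_log_symChannel (hPs P hP) hQ, ha, hb]
      simp
    refine epsITStar_eq hM0 hPs hU (Q₀ := symChannel M (((M : ℝ) - 1) / M))
      ⟨hS, fun P hP => (hamDist_symChannel (hPs P hP) _).trans_le hD⟩ (fun P hP => ?_)
      (fun Q hQ => ?_)
    · exact (MI_le hM0 (hPs P hP) hS).trans_eq (hzero P hP _ hS)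
    · refine (hzero _ hU Q hQ.1).symm.trans_le
        (le_MI_uniform hM0 hQ.1 hS.1 (hcol h0' (hD.trans h1)) fun i j h => ?_)
      unfold symChannel at h
      split_ifs at h
      · simp [h] at ha
      · simp [h] at hb
end

section
/- Let M ≥ 2, let 𝒫 be a nonempty, convex, compact set of probability vectors on Fin M (compact as a subset of Fin M → ℝ), and let D ≥ 0 be real. Then the minimax equality holds for worst-case information-theoretic leakage: sInf over (𝒫,D)-valid mechanisms Q of (sSup over P ∈ 𝒫 of I(P;Q)) equals sSup over P ∈ 𝒫 of (sInf over (𝒫,D)-valid mechanisms Q of I(P;Q)). -/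
open Finset

/-- The tangent line inequality for the perspective `u * log (u / v)` at slope `c`. -/
lemma mul_log_div_ge {u v c : ℝ} (hu : 0 ≤ u) (hv : 0 ≤ v) (huv : v = 0 → u = 0) (hc : 0 < c) :
    u * Real.log c + u - c * v ≤ u * Real.log (u / v) := by
  rcases hu.eq_or_lt with rfl | hu
  · simp; positivity
  have hv : 0 < v := hv.lt_of_ne fun h => hu.ne' (huv h.symm)
  have h := Real.log_le_sub_one_of_pos (show 0 < c * v / u by positivity)
  rw [Real.log_div (by positivity) hu.ne', Real.log_mul hc.ne' hv.ne'] at h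
  rw [Real.log_div hu.ne' hv.ne']
  have h' := mul_le_mul_of_nonneg_left h hu.le
  have e : u * (c * v / u - 1) = c * v - u := by field_simp
  linarith

/-- The two-term log sum inequality. -/
lemma add_mul_log_div_add_le {u₁ u₂ v₁ v₂ : ℝ} (hu₁ : 0 ≤ u₁) (hu₂ : 0 ≤ u₂)
    (hv₁ : 0 ≤ v₁) (hv₂ : 0 ≤ v₂) (h₁ : v₁ = 0 → u₁ = 0) (h₂ : v₂ = 0 → u₂ = 0) :
    (u₁ + u₂) * Real.log ((u₁ + u₂) / (v₁ + v₂)) ≤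
      u₁ * Real.log (u₁ / v₁) + u₂ * Real.log (u₂ / v₂) := by
  rcases (add_nonneg hu₁ hu₂).eq_or_lt with h | h
  · obtain rfl : u₁ = 0 := by linarith
    obtain rfl : u₂ = 0 := by linarith
    simp
  have hv : 0 < v₁ + v₂ := by
    refine (add_nonneg hv₁ hv₂).lt_of_ne fun hv => h.ne' ?_
    rw [h₁ (by linarith), h₂ (by linarith), add_zero]
  have hc := div_pos h hv
  have e : (u₁ + u₂) / (v₁ + v₂) * (v₁ + v₂) = u₁ + u₂ := div_mul_cancel₀ _ hv.ne'
  have := mul_log_div_ge hu₁ hv₁ h₁ hc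
  have := mul_log_div_ge hu₂ hv₂ h₂ hc
  linarith

lemma mul_mul_log_mul_div_mul (a x y : ℝ) :
    a * x * Real.log (a * x / (a * y)) = a * (x * Real.log (x / y)) := by
  rcases eq_or_ne a 0 with rfl | ha
  · simp
  · rw [mul_div_mul_left _ _ ha, mul_assoc]

lemma MI_term_convex {M : ℕ} {P : Fin M → ℝ} (hP : ∀ i, 0 ≤ P i) {Q R : Fin M → Fin M → ℝ}
    (hQ : ∀ i j, 0 ≤ Q i j) (hR : ∀ i j, 0 ≤ R i j) {a b : ℝ} (ha : 0 ≤ a) (hb : 0 ≤ b)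
    (i j : Fin M) :
    P i * (a * Q i j + b * R i j) *
        Real.log ((a * Q i j + b * R i j) / ∑ k, P k * (a * Q k j + b * R k j)) ≤
      a * (P i * Q i j * Real.log (Q i j / ∑ k, P k * Q k j)) +
        b * (P i * R i j * Real.log (R i j / ∑ k, P k * R k j)) := by
  rcases (hP i).eq_or_lt with hi | hi
  · simp [← hi]
  have hsum : ∑ k, P k * (a * Q k j + b * R k j) =
      a * ∑ k, P k * Q k j + b * ∑ k, P k * R k j := by
    rw [mul_sum, mul_sum, ← sum_add_distrib]
    exact sum_congr rfl fun k _ => by ring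
  have hnn {S : Fin M → Fin M → ℝ} (hS : ∀ i j, 0 ≤ S i j) : 0 ≤ ∑ k, P k * S k j :=
    sum_nonneg fun k _ => mul_nonneg (hP k) (hS k j)
  have hzero {S : Fin M → Fin M → ℝ} (hS : ∀ i j, 0 ≤ S i j) {c : ℝ}
      (h : c * ∑ k, P k * S k j = 0) : c * S i j = 0 := by
    rcases mul_eq_zero.1 h with rfl | h
    · simp
    · have := (sum_eq_zero_iff_of_nonneg fun k _ => mul_nonneg (hP k) (hS k j)).1 h i (mem_univ i)
      rw [(mul_eq_zero.1 this).resolve_left hi.ne', mul_zero]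
  have key := add_mul_log_div_add_le (mul_nonneg ha (hQ i j)) (mul_nonneg hb (hR i j))
    (mul_nonneg ha (hnn hQ)) (mul_nonneg hb (hnn hR)) (hzero hQ) (hzero hR)
  rw [mul_mul_log_mul_div_mul, mul_mul_log_mul_div_mul] at key
  rw [hsum]
  linarith [mul_le_mul_of_nonneg_left key hi.le]

lemma convexOn_MI {M : ℕ} {P : Fin M → ℝ} (hP : ∀ i, 0 ≤ P i) {X : Set (Fin M → Fin M → ℝ)}
    (hX : Convex ℝ X) (hnn : ∀ Q ∈ X, ∀ i j, 0 ≤ Q i j) : ConvexOn ℝ X fun Q => MI P Q := by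
  refine ⟨hX, fun Q hQ R hR a b ha hb _ => ?_⟩
  simp only [MI, smul_eq_mul, mul_sum, ← sum_add_distrib, Pi.add_apply, Pi.smul_apply]
  exact sum_le_sum fun i _ => sum_le_sum fun j _ =>
    MI_term_convex hP (hnn Q hQ) (hnn R hR) ha hb i j

lemma MI_eq {M : ℕ} {P : Fin M → ℝ} {Q : Fin M → Fin M → ℝ} (hP : ∀ i, 0 ≤ P i)
    (hQ : ∀ i j, 0 ≤ Q i j) :
    MI P Q = ∑ i, P i * ∑ j, Q i j * Real.log (Q i j) +
      ∑ j, Real.negMulLog (∑ k, P k * Q k j) := by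
  have h (i j) : P i * Q i j * Real.log (Q i j / ∑ k, P k * Q k j) =
      P i * (Q i j * Real.log (Q i j)) - P i * Q i j * Real.log (∑ k, P k * Q k j) := by
    rcases eq_or_ne (P i * Q i j) 0 with h0 | h0
    · rw [← mul_assoc, h0]; simp
    have hs : ∑ k, P k * Q k j ≠ 0 := fun h => h0 <|
      (sum_eq_zero_iff_of_nonneg fun k _ => mul_nonneg (hP k) (hQ k j)).1 h i (mem_univ i)
    rw [Real.log_div (right_ne_zero_of_mul h0) hs]
    ring
  simp only [MI, h, sum_sub_distrib, mul_sum, Real.negMulLog_eq_neg, sum_neg_distrib]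
  rw [sum_comm (f := fun i j => P i * Q i j * Real.log (∑ k, P k * Q k j))]
  simp only [sum_mul, ← sub_eq_add_neg]

lemma concaveOn_MI {M : ℕ} {Q : Fin M → Fin M → ℝ} (hQ : ∀ i j, 0 ≤ Q i j)
    {Y : Set (Fin M → ℝ)} (hY : Convex ℝ Y) (hnn : ∀ P ∈ Y, ∀ i, 0 ≤ P i) :
    ConcaveOn ℝ Y fun P => MI P Q := by
  refine ⟨hY, fun P hP R hR a b ha hb hab => ?_⟩
  simp only
  rw [MI_eq (hnn P hP) hQ, MI_eq (hnn R hR) hQ, MI_eq (hnn _ (hY hP hR ha hb hab)) hQ]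
  have hlin (f : Fin M → ℝ) : ∑ i, (a • P + b • R) i * f i =
      a * ∑ i, P i * f i + b * ∑ i, R i * f i := by
    simp only [mul_sum, ← sum_add_distrib, Pi.add_apply, Pi.smul_apply, smul_eq_mul]
    exact sum_congr rfl fun i _ => by ring
  have hnl : a * ∑ j, Real.negMulLog (∑ k, P k * Q k j) +
      b * ∑ j, Real.negMulLog (∑ k, R k * Q k j) ≤
      ∑ j, Real.negMulLog (∑ k, (a • P + b • R) k * Q k j) := by
    rw [mul_sum, mul_sum, ← sum_add_distrib]
    refine sum_le_sum fun j _ => ?_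
    rw [hlin fun k => Q k j]
    exact Real.concaveOn_negMulLog.2
      (sum_nonneg fun k _ => mul_nonneg (hnn P hP k) (hQ k j))
      (sum_nonneg fun k _ => mul_nonneg (hnn R hR k) (hQ k j)) ha hb hab
  rw [hlin]
  simp only [smul_eq_mul]
  linarith

lemma continuousOn_MI_right {M : ℕ} {P : Fin M → ℝ} (hP : ∀ i, 0 ≤ P i)
    {X : Set (Fin M → Fin M → ℝ)} (hnn : ∀ Q ∈ X, ∀ i j, 0 ≤ Q i j) :
    ContinuousOn (fun Q => MI P Q) X := by
  refine ContinuousOn.congr (Continuous.continuousOn ?_) fun Q hQ => MI_eq hP (hnn Q hQ)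
  fun_prop

lemma continuousOn_MI_left {M : ℕ} {Q : Fin M → Fin M → ℝ} (hQ : ∀ i j, 0 ≤ Q i j)
    {Y : Set (Fin M → ℝ)} (hnn : ∀ P ∈ Y, ∀ i, 0 ≤ P i) :
    ContinuousOn (fun P => MI P Q) Y := by
  refine ContinuousOn.congr (Continuous.continuousOn ?_) fun P hP => MI_eq (hnn P hP) hQ
  fun_prop

lemma convex_setOf_PDValid {M : ℕ} (Ps : Set (Fin M → ℝ)) (D : ℝ) :
    Convex ℝ {Q | PDValid Ps D Q} := by
  rintro Q ⟨⟨hQ, hQ1⟩, hQD⟩ R ⟨⟨hR, hR1⟩, hRD⟩ a b ha hb hab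
  refine ⟨⟨fun i j => ?_, fun i => ?_⟩, fun P hP => ?_⟩
  · exact add_nonneg (mul_nonneg ha (hQ i j)) (mul_nonneg hb (hR i j))
  · simp [sum_add_distrib, ← mul_sum, hQ1, hR1, hab]
  · have e : hamDist P (a • Q + b • R) = a * hamDist P Q + b * hamDist P R := by
      simp only [hamDist, mul_sum, ← sum_add_distrib, Pi.add_apply, Pi.smul_apply, smul_eq_mul]
      refine sum_congr rfl fun i _ => ?_
      linear_combination -P i * hab
    rw [e]
    calc a * hamDist P Q + b * hamDist P R ≤ a * D + b * D :=
          add_le_add (mul_le_mul_of_nonneg_left (hQD P hP) ha)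
            (mul_le_mul_of_nonneg_left (hRD P hP) hb)
      _ = D := by rw [← add_mul, hab, one_mul]

lemma isCompact_setOf_PDValid {M : ℕ} (Ps : Set (Fin M → ℝ)) (D : ℝ) :
    IsCompact {Q | PDValid Ps D Q} := by
  refine (isCompact_Icc (a := (0 : Fin M → Fin M → ℝ)) (b := 1)).of_isClosed_subset ?_ ?_
  · simp only [PDValid, IsMech, hamDist, Set.ofPred_and, Set.ofPred_forall]
    refine (IsClosed.inter ?_ ?_).inter ?_
    · exact isClosed_iInter fun i => isClosed_iInter fun j =>
        isClosed_le (by fun_prop) (by fun_prop)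
    · exact isClosed_iInter fun i => isClosed_eq (by fun_prop) (by fun_prop)
    · exact isClosed_iInter fun P => isClosed_iInter fun _ =>
        isClosed_le (by fun_prop) (by fun_prop)
  · rintro Q ⟨⟨hQ, hQ1⟩, -⟩
    refine ⟨fun i j => hQ i j, fun i j => ?_⟩
    simp only [Pi.one_apply]
    rw [← hQ1 i]
    exact single_le_sum (fun k _ => hQ i k) (mem_univ j)

lemma PDValid_one {M : ℕ} (Ps : Set (Fin M → ℝ)) {D : ℝ} (hD : 0 ≤ D) :
    PDValid Ps D fun i j => if i = j then 1 else 0 := by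
  refine ⟨⟨fun i j => ?_, fun i => by simp⟩, fun P _ => by simpa [hamDist] using hD⟩
  dsimp only
  split_ifs <;> norm_num

theorem stmt15 {M : ℕ} (hM : 2 ≤ M) (Ps : Set (Fin M → ℝ))
    (hne : Ps.Nonempty) (hPs : ∀ P ∈ Ps, IsProb P)
    (hconv : Convex ℝ Ps) (hcomp : IsCompact Ps)
    (D : ℝ) (hD : 0 ≤ D) :
    sInf {x : ℝ | ∃ Q : Fin M → Fin M → ℝ, PDValid Ps D Q ∧
        x = sSup {y : ℝ | ∃ P ∈ Ps, y = MI P Q}} =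
      sSup {y : ℝ | ∃ P ∈ Ps,
        y = sInf {x : ℝ | ∃ Q : Fin M → Fin M → ℝ, PDValid Ps D Q ∧ x = MI P Q}} := by
  have hnnP : ∀ P ∈ Ps, ∀ i, 0 ≤ P i := fun P hP => (hPs P hP).1
  have hnnQ : ∀ Q ∈ {Q | PDValid Ps D Q}, ∀ i j, 0 ≤ Q i j := fun Q hQ => hQ.1.1
  obtain ⟨Q₀, hQ₀, P₀, hP₀, hsaddle⟩ := Sion.exists_isSaddlePointOn
    (X := {Q | PDValid Ps D Q}) (Y := Ps) (f := fun Q P => MI P Q)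
    ⟨_, PDValid_one Ps hD⟩ (convex_setOf_PDValid Ps D) (isCompact_setOf_PDValid Ps D)
    (fun P hP => (continuousOn_MI_right (hnnP P hP) hnnQ).lowerSemicontinuousOn)
    (fun P hP => (convexOn_MI (hnnP P hP) (convex_setOf_PDValid Ps D) hnnQ).quasiconvexOn)
    hconv hne hcomp
    (fun Q hQ => (continuousOn_MI_left (hnnQ Q hQ) hnnP).upperSemicontinuousOn)
    (fun Q hQ => (concaveOn_MI (hnnQ Q hQ) hconv hnnP).quasiconcaveOn)
  have hset (Q) : {y : ℝ | ∃ P ∈ Ps, y = MI P Q} = (fun P => MI P Q) '' Ps := by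
    ext y; simp [eq_comm]
  have hset' (P) : {x : ℝ | ∃ Q : Fin M → Fin M → ℝ, PDValid Ps D Q ∧ x = MI P Q} =
      (fun Q => MI P Q) '' {Q | PDValid Ps D Q} := by
    ext y; simp [eq_comm]
  have hsup : IsGreatest {y : ℝ | ∃ P ∈ Ps, y = MI P Q₀} (MI P₀ Q₀) :=
    ⟨⟨P₀, hP₀, rfl⟩, by rintro _ ⟨P, hP, rfl⟩; exact hsaddle Q₀ hQ₀ P hP⟩
  have hinf : IsLeast {x : ℝ | ∃ Q : Fin M → Fin M → ℝ, PDValid Ps D Q ∧ x = MI P₀ Q}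
      (MI P₀ Q₀) :=
    ⟨⟨Q₀, hQ₀, rfl⟩, by rintro _ ⟨Q, hQ, rfl⟩; exact hsaddle Q hQ P₀ hP₀⟩
  trans MI P₀ Q₀
  · refine IsLeast.csInf_eq ⟨⟨Q₀, hQ₀, hsup.csSup_eq.symm⟩, ?_⟩
    rintro _ ⟨Q, hQ, rfl⟩
    refine le_trans (hinf.2 ⟨Q, hQ, rfl⟩) (le_csSup ?_ ⟨P₀, hP₀, rfl⟩)
    rw [hset]
    exact hcomp.bddAbove_image (continuousOn_MI_left (hnnQ Q hQ) hnnP)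
  · symm
    refine IsGreatest.csSup_eq ⟨⟨P₀, hP₀, hinf.csInf_eq.symm⟩, ?_⟩
    rintro _ ⟨P, hP, rfl⟩
    refine le_trans (csInf_le ?_ ⟨Q₀, hQ₀, rfl⟩) (hsup.2 ⟨P, hP, rfl⟩)
    rw [hset']
    exact (isCompact_setOf_PDValid Ps D).bddBelow_image (continuousOn_MI_right (hnnP P hP) hnnQ)
end
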